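/- arXiv:1806.00638 — 3 statements merged into one kernel-verified Lean document; each statement's English description precedes it below -/
import Mathlib

section
/- Let F be any field and let H be a forest with h vertices and at least one edge. Then every graph G on n vertices whose complement is H-free satisfies minrk_F(G) ≤ h − 1. -/
open Matrix

/-- `M` represents the graph `G` over a field: nonzero diagonal entries, and zero entries at
off-diagonal non-adjacent pairs. -/
def Represents {F V : Type*} [Field F] (M : Matrix V V F) (G : SimpleGraph V) : Prop :=
  (∀ v, M v v ≠ 0) ∧ ∀ u v, u ≠ v → ¬ G.Adj u v → M u v = 0

/-- The minrank of a graph `G` over a field `F`: the minimum possible rank of a matrix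
representing `G`. -/
noncomputable def minrk (F : Type*) [Field F] {V : Type*} [Fintype V]
    (G : SimpleGraph V) : ℕ :=
  sInf { r : ℕ | ∃ M : Matrix V V F, Represents M G ∧ M.rank = r }

/-- `G` contains a copy of `H` as a (not necessarily induced) subgraph, i.e. there is an
injective graph homomorphism from `H` to `G`. -/
def ContainsCopy {V W : Type*} (H : SimpleGraph W) (G : SimpleGraph V) : Prop :=
  ∃ f : W → V, Function.Injective f ∧ ∀ a b, H.Adj a b → G.Adj (f a) (f b)

/-- Every nonempty finite set of vertices of a forest contains a vertex with at most one
neighbour inside the set. -/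
theorem SimpleGraph.IsAcyclic.exists_mem_subsingleton_adj {W : Type*} {H : SimpleGraph W}
    (hH : H.IsAcyclic) {T : Finset W} (hT : T.Nonempty) :
    ∃ v ∈ T, ∀ a ∈ T, ∀ b ∈ T, H.Adj v a → H.Adj v b → a = b := by
  classical
  rcases subsingleton_or_nontrivial T with hs | hs
  · obtain ⟨v, hv⟩ := hT
    refine ⟨v, hv, fun a ha b hb _ _ => ?_⟩
    exact congrArg Subtype.val (Subsingleton.elim (⟨a, ha⟩ : T) ⟨b, hb⟩)
  · have hac : (H.comap (Function.Embedding.subtype (· ∈ T))).IsAcyclic := hH.of_comap _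
    obtain ⟨R, hle, -, hR⟩ :=
      SimpleGraph.connected_top.exists_isTree_le_of_le_of_isAcyclic le_top hac
    obtain ⟨v, hv⟩ := hR.exists_vert_degree_one_of_nontrivial
    obtain ⟨u, -, hu⟩ := SimpleGraph.degree_eq_one_iff_existsUnique_adj.mp hv
    refine ⟨v, v.2, fun a ha b hb hva hvb => ?_⟩
    have h₁ := hu ⟨a, ha⟩ (hle hva)
    have h₂ := hu ⟨b, hb⟩ (hle hvb)
    exact congrArg Subtype.val (h₁.trans h₂.symm)

/-- A graph of minimum degree at least `k` on a nonempty vertex set `S` contains, within `S`, every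
forest on at most `k + 1` vertices. -/
theorem SimpleGraph.IsAcyclic.exists_injOn_adj {V W : Type*}
    {H : SimpleGraph W} (hH : H.IsAcyclic) (G : SimpleGraph V) [DecidableRel G.Adj] {k : ℕ}
    {S : Finset V} (hS : S.Nonempty) (hdeg : ∀ s ∈ S, k ≤ (S.filter (G.Adj s)).card)
    (T : Finset W) (hT : T.card ≤ k + 1) :
    ∃ f : W → V, Set.InjOn f T ∧ (∀ a ∈ T, f a ∈ S) ∧
      ∀ a ∈ T, ∀ b ∈ T, H.Adj a b → G.Adj (f a) (f b) := by
  classical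
  induction hm : T.card generalizing T with
  | zero =>
    obtain ⟨s, -⟩ := hS
    obtain rfl := Finset.card_eq_zero.mp hm
    exact ⟨fun _ => s, by simp⟩
  | succ m ih =>
    obtain ⟨v, hvT, hv⟩ := hH.exists_mem_subsingleton_adj
      (Finset.card_pos.mp (by omega : 0 < T.card))
    have hcard := Finset.card_erase_of_mem hvT
    obtain ⟨f, hinj, hfS, hadj⟩ := ih (T.erase v) (by omega) (by omega)
    obtain ⟨x, hxS, hxnot, hx⟩ : ∃ x ∈ S, x ∉ (T.erase v).image f ∧
        ∀ a ∈ T, H.Adj v a → G.Adj x (f a) := by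
      by_cases hw : ∃ w ∈ T, H.Adj v w
      · obtain ⟨w, hwT, hvw⟩ := hw
        have hwE : w ∈ T.erase v := Finset.mem_erase.mpr ⟨hvw.ne', hwT⟩
        have hlt : (((T.erase v).erase w).image f).card < (S.filter (G.Adj (f w))).card := by
          have h₁ := hdeg (f w) (hfS w hwE)
          have h₂ := Finset.card_image_le (s := (T.erase v).erase w) (f := f)
          have h₃ := Finset.card_erase_of_mem hwE
          have h₄ := Finset.card_pos.mpr ⟨w, hwE⟩
          omega
        obtain ⟨x, hx, hxn⟩ := Finset.exists_mem_notMem_of_card_lt_card hlt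
        rw [Finset.mem_filter] at hx
        refine ⟨x, hx.1, fun hmem => ?_, fun a ha hva => ?_⟩
        · obtain ⟨a, ha, rfl⟩ := Finset.mem_image.mp hmem
          by_cases haw : a = w
          · exact hx.2.ne (by rw [haw])
          · exact hxn (Finset.mem_image_of_mem f (Finset.mem_erase.mpr ⟨haw, ha⟩))
        · rw [hv a ha w hwT hva hvw]
          exact hx.2.symm
      · push Not at hw
        have hlt : ((T.erase v).image f).card < S.card := by
          obtain ⟨s, hs⟩ := hS
          have h₁ := hdeg s hs
          have h₂ : (S.filter (G.Adj s)).card < S.card :=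
            Finset.card_lt_card (Finset.filter_ssubset.mpr ⟨s, hs, G.irrefl⟩)
          have h₃ := Finset.card_image_le (s := T.erase v) (f := f)
          omega
        obtain ⟨x, hx, hxn⟩ := Finset.exists_mem_notMem_of_card_lt_card hlt
        exact ⟨x, hx, hxn, fun a ha hva => absurd hva (hw a ha)⟩
    have hne : ∀ a ∈ T, a ≠ v → f a ≠ x := fun a ha hav h =>
      hxnot (h ▸ Finset.mem_image_of_mem f (Finset.mem_erase.mpr ⟨hav, ha⟩))
    refine ⟨Function.update f v x, fun a ha b hb hab => ?_, fun a ha => ?_, fun a ha b hb hab => ?_⟩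
    · by_cases hav : a = v <;> by_cases hbv : b = v
      · rw [hav, hbv]
      · subst hav
        simp only [Function.update_self, Function.update_of_ne hbv] at hab
        exact absurd hab.symm (hne b hb hbv)
      · subst hbv
        simp only [Function.update_self, Function.update_of_ne hav] at hab
        exact absurd hab (hne a ha hav)
      · simp only [Function.update_of_ne hav, Function.update_of_ne hbv] at hab
        exact hinj (by simpa [hav] using ha) (by simpa [hbv] using hb) hab
    · by_cases hav : a = v
      · simpa [hav] using hxS
      · simpa [hav] using hfS a (Finset.mem_erase.mpr ⟨hav, ha⟩)
    · by_cases hav : a = v <;> by_cases hbv : b = v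
      · exact absurd (hav.trans hbv.symm) hab.ne
      · subst hav
        simpa [hbv] using hx b hb hab
      · subst hbv
        simpa [hav] using (hx a ha hab.symm).symm
      · simpa [hav, hbv] using hadj a (Finset.mem_erase.mpr ⟨hav, ha⟩) b
          (Finset.mem_erase.mpr ⟨hbv, hb⟩) hab

/-- Greedy colouring: if every nonempty set of vertices has a member with fewer than `k` neighbours
inside the set, then the graph is `k`-colorable. -/
theorem SimpleGraph.colorable_of_forall_exists_card_filter_adj_lt {V : Type*} [Fintype V]
    (G : SimpleGraph V) [DecidableRel G.Adj] {k : ℕ} (hk : 0 < k)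
    (hG : ∀ S : Finset V, S.Nonempty → ∃ s ∈ S, (S.filter (G.Adj s)).card < k) :
    G.Colorable k := by
  classical
  suffices h : ∀ S : Finset V, ∃ c : V → Fin k, ∀ a ∈ S, ∀ b ∈ S, G.Adj a b → c a ≠ c b by
    obtain ⟨c, hc⟩ := h Finset.univ
    exact ⟨SimpleGraph.Coloring.mk c fun {a b} hab =>
      hc a (Finset.mem_univ a) b (Finset.mem_univ b) hab⟩
  intro S
  induction S using Finset.strongInduction with
  | H S ih =>
    rcases S.eq_empty_or_nonempty with rfl | hS
    · exact ⟨fun _ => ⟨0, hk⟩, by simp⟩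
    obtain ⟨s, hs, hlt⟩ := hG S hS
    obtain ⟨c, hc⟩ := ih _ (Finset.erase_ssubset hs)
    have hcard : ((S.filter (G.Adj s)).image c).card < (Finset.univ : Finset (Fin k)).card := by
      rw [Finset.card_univ, Fintype.card_fin]
      exact Finset.card_image_le.trans_lt hlt
    obtain ⟨x, -, hx⟩ := Finset.exists_mem_notMem_of_card_lt_card hcard
    have hne : ∀ a ∈ S, G.Adj s a → c a ≠ x := fun a ha hsa h =>
      hx (h ▸ Finset.mem_image_of_mem c (Finset.mem_filter.mpr ⟨ha, hsa⟩))
    refine ⟨Function.update c s x, fun a ha b hb hab => ?_⟩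
    by_cases has : a = s <;> by_cases hbs : b = s
    · exact absurd (has.trans hbs.symm) hab.ne
    · subst has
      simpa [hbs] using (hne b hb hab).symm
    · subst hbs
      simpa [has] using hne a ha hab.symm
    · simpa [has, hbs] using hc a (Finset.mem_erase.mpr ⟨has, ha⟩) b
        (Finset.mem_erase.mpr ⟨hbs, hb⟩) hab

/-- The minrank of a graph is at most the chromatic number of its complement. -/
theorem minrk_le_of_compl_colorable (F : Type*) [Field F] {V : Type*} [Fintype V]
    {G : SimpleGraph V} {k : ℕ} (hG : Gᶜ.Colorable k) : minrk F G ≤ k := by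
  classical
  obtain ⟨c⟩ := hG
  let A : Matrix V (Fin k) F := Matrix.of fun u i => if c u = i then 1 else 0
  have hA : ∀ u v, (A * Aᵀ) u v = if c u = c v then 1 else 0 := fun u v => by
    simp [A, Matrix.mul_apply, eq_comm]
  have hrep : Represents (A * Aᵀ) G := by
    refine ⟨fun v => by simp [hA], fun u v huv hadj => ?_⟩
    rw [hA, if_neg (c.valid ((SimpleGraph.compl_adj G u v).mpr ⟨huv, hadj⟩))]
  have hmin : minrk F G ≤ (A * Aᵀ).rank := Nat.sInf_le ⟨A * Aᵀ, hrep, rfl⟩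
  exact hmin.trans ((Matrix.rank_mul_le_left A Aᵀ).trans (by simpa using A.rank_le_card_width))

/-- For any field F and any forest H on h vertices with at least one edge,
every n-vertex graph G whose complement is H-free satisfies minrk_F(G) ≤ h - 1. -/
theorem minrk_le_of_compl_forest_free (F : Type*) [Field F] {h n : ℕ}
    (H : SimpleGraph (Fin h)) (hH : H.IsAcyclic) (hedge : ∃ a b, H.Adj a b)
    (G : SimpleGraph (Fin n)) (hfree : ¬ ContainsCopy H Gᶜ) :
    minrk F G ≤ h - 1 := by
  classical
  obtain ⟨a, b, hab⟩ := hedge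
  have h_one : 1 < h := by
    simpa using Fintype.one_lt_card_iff.mpr ⟨a, b, hab.ne⟩
  refine minrk_le_of_compl_colorable F
    (SimpleGraph.colorable_of_forall_exists_card_filter_adj_lt _ (by omega) fun S hS => ?_)
  by_contra! hdeg
  obtain ⟨f, hinj, -, hadj⟩ := hH.exists_injOn_adj Gᶜ hS hdeg Finset.univ
    (by rw [Finset.card_univ, Fintype.card_fin]; omega)
  exact hfree ⟨f, by simpa [Set.injOn_univ] using hinj,
    fun a b hab => hadj a (Finset.mem_univ a) b (Finset.mem_univ b) hab⟩
end

section
/- Let F be any field, let H be a tree with h ≥ 2 vertices, and let n be an integer with n ≥ h − 1. Then there exists a graph G on n vertices whose complement is H-free such that minrk_F(G) = h − 1. -/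
open Matrix

/-- The graph on `Fin n` in which two distinct vertices are adjacent unless both are below `k`. -/
def independentJoin (n k : ℕ) : SimpleGraph (Fin n) where
  Adj u v := u ≠ v ∧ ¬ (u.val < k ∧ v.val < k)
  symm := ⟨fun _ _ h => ⟨h.1.symm, fun h' => h.2 h'.symm⟩⟩
  loopless := ⟨fun _ h => h.1 rfl⟩

theorem not_containsCopy_compl_independentJoin {h n k : ℕ} {H : SimpleGraph (Fin h)}
    (hH : H.Connected) (hh : 2 ≤ h) (hk : k < h) :
    ¬ ContainsCopy H (independentJoin n k)ᶜ := by
  rintro ⟨f, hf, hadj⟩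
  have : Nontrivial (Fin h) := Fin.nontrivial_iff_two_le.mpr hh
  have hlt (a : Fin h) : (f a).val < k := by
    obtain ⟨b, hb⟩ := hH.preconnected.exists_adj_of_nontrivial a
    have := hadj a b hb
    rw [SimpleGraph.compl_adj] at this
    by_contra hcon
    exact this.2 ⟨this.1, fun h' => hcon h'.1⟩
  have hinj : Function.Injective (fun a => (⟨(f a).val, hlt a⟩ : Fin k)) := fun a b hab =>
    hf (Fin.ext (Fin.mk.inj hab))
  have := Fintype.card_le_of_injective _ hinj
  simp only [Fintype.card_fin] at this
  omega

/-- An independent set bounds the rank of every representing matrix from below. -/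
theorem Represents.card_le_rank {F V ι : Type*} [Field F] [Fintype V] [Fintype ι]
    {M : Matrix V V F} {G : SimpleGraph V} (hM : Represents M G) (e : ι → V)
    (he : Function.Injective e) (hind : ∀ i j, ¬ G.Adj (e i) (e j)) :
    Fintype.card ι ≤ M.rank := by
  classical
  have hsub : M.submatrix e e = Matrix.diagonal (fun i => M (e i) (e i)) := by
    ext i j
    rcases eq_or_ne i j with rfl | hij
    · simp
    · simpa [hij] using hM.2 _ _ (he.ne hij) (hind i j)
  have hrank : (M.submatrix e e).rank = Fintype.card ι := by
    rw [hsub]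
    refine Matrix.rank_of_isUnit _ ((Matrix.isUnit_iff_isUnit_det _).mpr ?_)
    rw [Matrix.det_diagonal]
    exact (Finset.prod_ne_zero_iff.mpr fun i _ => hM.1 _).isUnit
  rw [← hrank]
  exact Matrix.rank_submatrix_le M e e

/-- A cover by cliques, given as the fibres of `c`, yields a representing matrix of small rank. -/
theorem exists_represents_rank_le_card (F : Type*) {V ι : Type*} [Field F] [Fintype V]
    [Fintype ι] {G : SimpleGraph V} (c : V → ι)
    (hc : ∀ u v, u ≠ v → c u = c v → G.Adj u v) :
    ∃ M : Matrix V V F, Represents M G ∧ M.rank ≤ Fintype.card ι := by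
  classical
  let A : Matrix V ι F := Matrix.of fun v i => if c v = i then 1 else 0
  have hA (u v : V) : (A * Aᵀ) u v = if c u = c v then 1 else 0 := by
    simp [A, Matrix.mul_apply, eq_comm]
  refine ⟨A * Aᵀ, ⟨fun v => by simp [hA], fun u v huv hadj => ?_⟩,
    (Matrix.rank_mul_le_left A Aᵀ).trans A.rank_le_card_width⟩
  rw [hA, if_neg fun h => hadj (hc u v huv h)]

theorem minrk_eq_card (F : Type*) {V ι : Type*} [Field F] [Fintype V] [Fintype ι]
    {G : SimpleGraph V} (e : ι → V) (he : Function.Injective e)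
    (hind : ∀ i j, ¬ G.Adj (e i) (e j)) (c : V → ι)
    (hc : ∀ u v, u ≠ v → c u = c v → G.Adj u v) :
    minrk F G = Fintype.card ι := by
  obtain ⟨M, hM, hle⟩ := exists_represents_rank_le_card F c hc
  have hmem : M.rank ∈ {r : ℕ | ∃ M : Matrix V V F, Represents M G ∧ M.rank = r} := ⟨M, hM, rfl⟩
  refine le_antisymm ((Nat.sInf_le hmem).trans hle) (le_csInf ⟨_, hmem⟩ ?_)
  rintro _ ⟨N, hN, rfl⟩
  exact hN.card_le_rank e he hind

theorem minrk_independentJoin (F : Type*) [Field F] {n k : ℕ} (hk : 0 < k) (hn : k ≤ n) :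
    minrk F (independentJoin n k) = k := by
  have := minrk_eq_card F (ι := Fin k) (G := independentJoin n k)
    (Fin.castLE hn) (Fin.castLE_injective hn)
    (fun i j hij => hij.2 ⟨i.isLt, j.isLt⟩)
    (fun v => if hv : v.val < k then (⟨v.val, hv⟩ : Fin k) else ⟨0, hk⟩) (by
      rintro u v huv huc
      refine ⟨huv, fun ⟨hu, hv⟩ => huv (Fin.ext ?_)⟩
      simpa [hu, hv] using huc)
  simpa using this

/-- For any field F, any tree H on h ≥ 2 vertices, and any n ≥ h - 1, there is an
n-vertex graph G whose complement is H-free with minrk_F(G) = h - 1. -/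
theorem exists_compl_tree_free_minrk_eq (F : Type*) [Field F] {h n : ℕ}
    (H : SimpleGraph (Fin h)) (hH : H.IsTree) (hh : 2 ≤ h) (hn : h - 1 ≤ n) :
    ∃ G : SimpleGraph (Fin n), ¬ ContainsCopy H Gᶜ ∧ minrk F G = h - 1 := by
  exact ⟨independentJoin n (h - 1),
    not_containsCopy_compl_independentJoin hH.connected hh (by omega),
    minrk_independentJoin F (by omega) hn⟩
end

section
/- Let H be a graph with h ≥ 3 vertices and f ≥ 3 edges, and set γ(H) = (h−2)/(f−1). There exists a constant c > 0, depending only on H, such that for every integer n ≥ 2 and every finite field F, there exists a graph G on n vertices whose complement is H-free and which satisfies minrk_F(G) ≥ c · n^{1−γ(H)} / log(n · |F|). -/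
open Matrix

/-- In the binomial random subset of `α` with density `p`, the event of containing `D` and avoiding
`A` has probability `p ^ #D * (1 - p) ^ #A`. -/
lemma sum_binomial_weight_of_subset_of_disjoint {α : Type*} [Fintype α] [DecidableEq α] (p : ℝ)
    {D A : Finset α} (hDA : Disjoint D A) :
    ∑ E : Finset α with D ⊆ E ∧ Disjoint E A, p ^ E.card * (1 - p) ^ Eᶜ.card =
      p ^ D.card * (1 - p) ^ A.card := by
  classical
  have key := Finset.prod_add (fun e => if e ∈ A then 0 else p)
    (fun e => if e ∈ D then 0 else 1 - p) (Finset.univ : Finset α)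
  have hleft : ∏ e : α, ((if e ∈ A then 0 else p) + (if e ∈ D then 0 else 1 - p)) =
      (∏ e : α, if e ∈ D then p else 1) * ∏ e : α, if e ∈ A then 1 - p else 1 := by
    rw [← Finset.prod_mul_distrib]
    refine Finset.prod_congr rfl fun e _ => ?_
    by_cases hD : e ∈ D
    · have hA : e ∉ A := Finset.disjoint_left.1 hDA hD
      simp [hD, hA]
    · by_cases hA : e ∈ A <;> simp [hD, hA]
  rw [hleft, Finset.prod_ite_mem, Finset.prod_ite_mem, Finset.univ_inter, Finset.univ_inter,
    Finset.prod_const, Finset.prod_const] at key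
  rw [key, Finset.powerset_univ, Finset.sum_filter]
  refine Finset.sum_congr rfl fun E _ => ?_
  split_ifs with hE
  · congr 1
    · rw [Finset.prod_congr rfl (g := fun _ => p), Finset.prod_const]
      intro e he
      simp [Finset.disjoint_left.1 hE.2 he]
    · rw [Finset.compl_eq_univ_sdiff, Finset.prod_congr rfl (g := fun _ => 1 - p),
        Finset.prod_const]
      intro e he
      have : e ∉ D := fun h => (Finset.mem_sdiff.1 he).2 (hE.1 h)
      simp [this]
  · rcases not_and_or.1 hE with h | h
    · obtain ⟨e, heD, heE⟩ := Finset.not_subset.1 h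
      rw [Finset.prod_eq_zero (i := e) (s := Finset.univ \ E) (by simp [heE]) (by simp [heD]),
        mul_zero]
    · obtain ⟨e, heE, heA⟩ := Finset.not_disjoint_iff.1 h
      rw [Finset.prod_eq_zero (i := e) (s := E) heE (by simp [heA]), zero_mul]

lemma sum_biUnion_le_of_nonneg {ι α : Type*} [DecidableEq α] (s : Finset ι) (t : ι → Finset α)
    (f : α → ℝ) (hf : ∀ a, 0 ≤ f a) : ∑ a ∈ s.biUnion t, f a ≤ ∑ i ∈ s, ∑ a ∈ t i, f a := by
  classical
  induction s using Finset.induction_on with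
  | empty => simp
  | insert i s hi ih =>
    rw [Finset.biUnion_insert, Finset.sum_insert hi]
    have hunion := Finset.sum_union_inter (s₁ := t i) (s₂ := s.biUnion t) (f := f)
    have : 0 ≤ ∑ a ∈ t i ∩ s.biUnion t, f a := Finset.sum_nonneg fun a _ => hf a
    linarith

open Classical in
/-- The total weight of the sets `E` for which some disjoint subfamily of `𝓗`, all of whose members
lie in `E`, covers `E ∩ S`. -/
lemma sum_binomial_weight_covered_le {α : Type*} [Fintype α] [DecidableEq α] {p : ℝ} {m : ℕ}
    (hp0 : 0 ≤ p) (hp : p ≤ 1 / 2) (𝓗 : Finset (Finset α)) (hcard : ∀ X ∈ 𝓗, X.card = m)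
    (S : Finset α) :
    ∑ E : Finset α with ∃ 𝓓 ⊆ 𝓗, (𝓓 : Set (Finset α)).PairwiseDisjoint id ∧
        𝓓.biUnion id ⊆ E ∧ E ∩ S ⊆ 𝓓.biUnion id, p ^ E.card * (1 - p) ^ Eᶜ.card ≤
      Real.exp (-(p * S.card) + 𝓗.card * (2 * p) ^ m) := by
  classical
  have h1p : 0 ≤ 1 - p := by linarith
  have hw : ∀ E : Finset α, 0 ≤ p ^ E.card * (1 - p) ^ Eᶜ.card := fun E => by positivity
  calc
    _ ≤ ∑ E ∈ (𝓗.powerset.filter fun 𝓓 : Finset (Finset α) =>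
          (𝓓 : Set (Finset α)).PairwiseDisjoint id).biUnion fun 𝓓 =>
          Finset.univ.filter fun E => 𝓓.biUnion id ⊆ E ∧ Disjoint E (S \ 𝓓.biUnion id),
        p ^ E.card * (1 - p) ^ Eᶜ.card := by
      refine Finset.sum_le_sum_of_subset_of_nonneg ?_ fun E _ _ => hw E
      intro E hE
      obtain ⟨𝓓, hsub, hdisj, hDE, hcov⟩ := (Finset.mem_filter.1 hE).2
      refine Finset.mem_biUnion.2 ⟨𝓓, by simp [hsub, hdisj], ?_⟩
      simp only [Finset.mem_filter, Finset.mem_univ, true_and]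
      refine ⟨hDE, Finset.disjoint_left.2 fun e heE he => ?_⟩
      rw [Finset.mem_sdiff] at he
      exact he.2 (hcov (Finset.mem_inter.2 ⟨heE, he.1⟩))
    _ ≤ ∑ 𝓓 ∈ 𝓗.powerset.filter fun 𝓓 : Finset (Finset α) =>
          (𝓓 : Set (Finset α)).PairwiseDisjoint id,
        ∑ E : Finset α with 𝓓.biUnion id ⊆ E ∧ Disjoint E (S \ 𝓓.biUnion id),
          p ^ E.card * (1 - p) ^ Eᶜ.card := by
      exact sum_biUnion_le_of_nonneg _ _ _ hw
    _ ≤ ∑ 𝓓 ∈ 𝓗.powerset.filter fun 𝓓 : Finset (Finset α) =>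
          (𝓓 : Set (Finset α)).PairwiseDisjoint id,
        (1 - p) ^ S.card * ((2 * p) ^ m) ^ 𝓓.card := by
      refine Finset.sum_le_sum fun 𝓓 h𝓓 => ?_
      rw [Finset.mem_filter, Finset.mem_powerset] at h𝓓
      rw [sum_binomial_weight_of_subset_of_disjoint p Finset.disjoint_sdiff]
      have hc : (𝓓.biUnion id).card = m * 𝓓.card := by
        rw [Finset.card_biUnion h𝓓.2,
          Finset.sum_congr rfl (f := fun X => (id X).card) (g := fun _ => m)
            fun X hX => hcard X (h𝓓.1 hX)]
        simp [mul_comm]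
      have hle : S.card ≤ m * 𝓓.card + (S \ 𝓓.biUnion id).card := by
        have := Finset.le_card_sdiff (𝓓.biUnion id) S
        omega
      rw [hc, ← pow_mul]
      calc p ^ (m * 𝓓.card) * (1 - p) ^ (S \ 𝓓.biUnion id).card
          ≤ ((1 - p) * (2 * p)) ^ (m * 𝓓.card) * (1 - p) ^ (S \ 𝓓.biUnion id).card := by
            gcongr
            nlinarith
        _ = (1 - p) ^ (m * 𝓓.card + (S \ 𝓓.biUnion id).card) * (2 * p) ^ (m * 𝓓.card) := by
            rw [mul_pow, pow_add]; ring
        _ ≤ _ := by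
            gcongr ?_ * _
            exact pow_le_pow_of_le_one h1p (by linarith) hle
    _ ≤ ∑ 𝓓 ∈ 𝓗.powerset, (1 - p) ^ S.card * ((2 * p) ^ m) ^ 𝓓.card :=
      Finset.sum_le_sum_of_subset_of_nonneg (Finset.filter_subset _ _) fun _ _ _ => by positivity
    _ = (1 - p) ^ S.card * (1 + (2 * p) ^ m) ^ 𝓗.card := by
      rw [← Finset.mul_sum, ← Finset.prod_const (1 + (2 * p) ^ m), Finset.prod_one_add]
      simp
    _ ≤ Real.exp (-p) ^ S.card * Real.exp ((2 * p) ^ m) ^ 𝓗.card := by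
      gcongr
      · linarith [Real.add_one_le_exp (-p)]
      · linarith [Real.add_one_le_exp ((2 * p) ^ m)]
    _ = _ := by
      rw [← Real.exp_nat_mul, ← Real.exp_nat_mul, ← Real.exp_add]
      congr 1
      ring

/-- If every element lies in few members of the uniform hypergraph `𝓗` and the sets `S i` are large,
then some set `Γ` contains no member of `𝓗` and meets every `S i`. -/
lemma exists_independent_transversal {α ι : Type*} [Fintype α] [DecidableEq α] {p Δ : ℝ} {m : ℕ}
    (hp0 : 0 ≤ p) (hp : p ≤ 1 / 2) (hm : m ≠ 0) (𝓗 : Finset (Finset α))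
    (hcard : ∀ X ∈ 𝓗, X.card = m)
    (hdeg : ∀ e, ((𝓗.filter fun X => e ∈ X).card : ℝ) ≤ Δ) (hΔ : Δ * (2 * p) ^ m ≤ p / 2)
    (I : Finset ι) (S : ι → Finset α)
    (hI : ∑ i ∈ I, Real.exp (-(p * (S i).card / 2)) < 1) :
    ∃ Γ : Finset α, (∀ X ∈ 𝓗, ¬ X ⊆ Γ) ∧ ∀ i ∈ I, (Γ ∩ S i).Nonempty := by
  classical
  have h1p : 0 ≤ 1 - p := by linarith
  have hw : ∀ E : Finset α, 0 ≤ p ^ E.card * (1 - p) ^ Eᶜ.card := fun E => by positivity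
  let 𝓗S : ι → Finset (Finset α) := fun i => 𝓗.filter fun X => (X ∩ S i).Nonempty
  let bad : ι → Finset (Finset α) := fun i =>
    Finset.univ.filter fun E => ∃ 𝓓 ⊆ 𝓗S i, (𝓓 : Set (Finset α)).PairwiseDisjoint id ∧
        𝓓.biUnion id ⊆ E ∧ E ∩ S i ⊆ 𝓓.biUnion id
  have hbad : ∀ i, ∑ E ∈ bad i, p ^ E.card * (1 - p) ^ Eᶜ.card ≤
      Real.exp (-(p * (S i).card / 2)) := by
    intro i
    refine (sum_binomial_weight_covered_le hp0 hp (𝓗S i)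
      (fun X hX => hcard X (Finset.mem_filter.1 hX).1) (S i)).trans ?_
    have hN : ((𝓗S i).card : ℝ) ≤ (S i).card * Δ := by
      have hsub : 𝓗S i ⊆ (S i).biUnion fun e => 𝓗.filter fun X => e ∈ X := by
        intro X hX
        obtain ⟨hX, e, he⟩ := Finset.mem_filter.1 hX
        rw [Finset.mem_inter] at he
        exact Finset.mem_biUnion.2 ⟨e, he.2, Finset.mem_filter.2 ⟨hX, he.1⟩⟩
      calc ((𝓗S i).card : ℝ) ≤ ∑ e ∈ S i, ((𝓗.filter fun X => e ∈ X).card : ℝ) := by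
            exact_mod_cast (Finset.card_le_card hsub).trans Finset.card_biUnion_le
        _ ≤ ∑ e ∈ S i, Δ := Finset.sum_le_sum fun e _ => hdeg e
        _ = _ := by simp
    have h2 : ((𝓗S i).card : ℝ) * (2 * p) ^ m ≤ (S i).card * (p / 2) := by
      calc ((𝓗S i).card : ℝ) * (2 * p) ^ m ≤ ((S i).card * Δ) * (2 * p) ^ m := by gcongr
        _ = (S i).card * (Δ * (2 * p) ^ m) := by ring
        _ ≤ _ := by gcongr
    apply Real.exp_le_exp.2
    linarith
  obtain ⟨E, hE⟩ : ∃ E, ∀ i ∈ I, E ∉ bad i := by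
    by_contra! hcon
    have htot : ∑ E : Finset α, p ^ E.card * (1 - p) ^ Eᶜ.card = 1 := by
      simpa using sum_binomial_weight_of_subset_of_disjoint p
        (Finset.disjoint_empty_left (∅ : Finset α))
    have hle : ∑ E : Finset α, p ^ E.card * (1 - p) ^ Eᶜ.card ≤
        ∑ i ∈ I, ∑ E ∈ bad i, p ^ E.card * (1 - p) ^ Eᶜ.card := by
      refine le_trans ?_ (sum_biUnion_le_of_nonneg I bad _ hw)
      refine Finset.sum_le_sum_of_subset_of_nonneg (fun E _ => ?_) fun E _ _ => hw E
      exact Finset.mem_biUnion.2 (hcon E)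
    have := Finset.sum_le_sum fun i (_ : i ∈ I) => hbad i
    linarith
  obtain ⟨𝓓, h𝓓⟩ := Finset.exists_maximal (s := 𝓗.powerset.filter fun 𝓓 : Finset (Finset α) =>
    (𝓓 : Set (Finset α)).PairwiseDisjoint id ∧ 𝓓.biUnion id ⊆ E) ⟨∅, by simp⟩
  obtain ⟨hsub, hdisj, hDE⟩ : 𝓓 ⊆ 𝓗 ∧ (𝓓 : Set (Finset α)).PairwiseDisjoint id ∧
      𝓓.biUnion id ⊆ E := by
    simpa only [Finset.mem_filter, Finset.mem_powerset] using h𝓓.prop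
  refine ⟨E \ 𝓓.biUnion id, fun X hX hXΓ => ?_, fun i hi => ?_⟩
  · have hXdisj : ∀ Y ∈ 𝓓, Disjoint X Y := fun Y hY =>
      (Finset.disjoint_sdiff.mono_right hXΓ).symm.mono_right
        (Finset.subset_biUnion_of_mem id hY)
    have hmem : X ∈ 𝓓 := by
      refine h𝓓.le_of_ge (y := insert X 𝓓) ?_ (Finset.subset_insert _ _)
        (Finset.mem_insert_self _ _)
      rw [Finset.mem_filter, Finset.mem_powerset]
      refine ⟨Finset.insert_subset hX hsub, ?_, ?_⟩
      · rw [Finset.coe_insert]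
        exact hdisj.insert fun Y hY _ => hXdisj Y hY
      · rw [Finset.biUnion_insert]
        exact Finset.union_subset (hXΓ.trans Finset.sdiff_subset) hDE
    have hX0 : X = ∅ := by simpa using hXdisj X hmem
    have := hcard X hX
    rw [hX0, Finset.card_empty] at this
    exact hm this.symm
  · by_contra hne
    rw [Finset.not_nonempty_iff_eq_empty] at hne
    refine hE i hi (Finset.mem_filter.2 ⟨Finset.mem_univ _,
      𝓓.filter fun X => (X ∩ S i).Nonempty, ?_, ?_, ?_, ?_⟩)
    · exact Finset.filter_subset_filter _ hsub
    · exact hdisj.subset (Finset.coe_subset.2 (Finset.filter_subset _ _))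
    · exact (Finset.biUnion_subset_biUnion_of_subset_left _ (Finset.filter_subset _ _)).trans hDE
    · intro e he
      rw [Finset.mem_inter] at he
      have heD : e ∈ 𝓓.biUnion id := by
        by_contra h
        have : e ∈ (E \ 𝓓.biUnion id) ∩ S i :=
          Finset.mem_inter.2 ⟨Finset.mem_sdiff.2 ⟨he.1, h⟩, he.2⟩
        rw [hne] at this
        simp at this
      obtain ⟨X, hX, heX⟩ := Finset.mem_biUnion.1 heD
      exact Finset.mem_biUnion.2 ⟨X, Finset.mem_filter.2 ⟨hX, e, Finset.mem_inter.2 ⟨heX, he.2⟩⟩,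
        heX⟩

/-- A basis adapted to a weight: it spans everything and meets every weight sublevel set in a
spanning set. -/
lemma exists_linearIndepOn_span_sublevel {F V W : Type*} [Field F] [AddCommGroup W] [Module F W]
    [DecidableEq V] (r : V → W) (w : V → ℕ) (T : Finset V) :
    ∃ R ⊆ T, LinearIndepOn F r (R : Set V) ∧ ∀ τ,
      Submodule.span F (r '' {v | v ∈ R ∧ w v ≤ τ}) =
        Submodule.span F (r '' {v | v ∈ T ∧ w v ≤ τ}) := by
  induction T using Finset.induction_on_max_value w with
  | empty => exact ⟨∅, subset_rfl, by simp, fun τ => rfl⟩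
  | insert a s ha hmax ih =>
    obtain ⟨R, hRs, hlin, hspan⟩ := ih
    have hall : Submodule.span F (r '' (R : Set V)) = Submodule.span F (r '' (s : Set V)) := by
      have h := hspan (w a)
      have h1 : {v | v ∈ R ∧ w v ≤ w a} = (R : Set V) := by
        ext v; simpa using fun hv => hmax v (hRs hv)
      have h2 : {v | v ∈ s ∧ w v ≤ w a} = (s : Set V) := by
        ext v; simpa using fun hv => hmax v hv
      rwa [h1, h2] at h
    have hlow : ∀ (U : Finset V) {τ}, τ < w a →
        {v | v ∈ insert a U ∧ w v ≤ τ} = {v | v ∈ U ∧ w v ≤ τ} := by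
      intro U τ hτ
      ext v
      simp only [Finset.mem_insert, Set.mem_ofPred_eq]
      constructor
      · rintro ⟨rfl | h, h'⟩
        · omega
        · exact ⟨h, h'⟩
      · rintro ⟨h, h'⟩
        exact ⟨Or.inr h, h'⟩
    have hhigh : ∀ U ⊆ s, ∀ {τ}, w a ≤ τ →
        {v | v ∈ insert a U ∧ w v ≤ τ} = insert a (U : Set V) ∧
          {v | v ∈ U ∧ w v ≤ τ} = (U : Set V) := by
      intro U hU τ hτ
      have hle : ∀ v ∈ U, w v ≤ τ := fun v hv => (hmax v (hU hv)).trans hτ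
      constructor <;> ext v <;> simp <;> grind
    by_cases hmem : r a ∈ Submodule.span F (r '' (s : Set V))
    · refine ⟨R, hRs.trans (Finset.subset_insert _ _), hlin, fun τ => ?_⟩
      rcases lt_or_ge τ (w a) with hτ | hτ
      · rw [hlow s hτ, hspan]
      · rw [(hhigh s subset_rfl hτ).1, (hhigh R hRs hτ).2, hall, Set.image_insert_eq,
          Submodule.span_insert_eq_span hmem]
    · refine ⟨insert a R, Finset.insert_subset_insert _ hRs, ?_, fun τ => ?_⟩
      · rw [Finset.coe_insert]
        exact hlin.insert (by rwa [hall])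
      · rcases lt_or_ge τ (w a) with hτ | hτ
        · rw [hlow s hτ, hlow R hτ, hspan]
        · rw [(hhigh s subset_rfl hτ).1, (hhigh R hRs hτ).1, Set.image_insert_eq,
            Set.image_insert_eq, Submodule.span_insert, Submodule.span_insert, hall]

lemma sum_eq_sum_range_card_lt {V : Type*} (w : V → ℕ) (s : Finset V) {B : ℕ}
    (hB : ∀ v ∈ s, w v ≤ B) :
    ∑ v ∈ s, w v = ∑ τ ∈ Finset.range B, (s.filter fun v => τ < w v).card := by
  simp only [Finset.card_filter]
  rw [Finset.sum_comm]
  refine Finset.sum_congr rfl fun v hv => ?_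
  rw [← Finset.card_filter]
  have : (Finset.range B).filter (fun τ => τ < w v) = Finset.range (w v) := by
    ext τ
    have := hB v hv
    simp
    omega
  rw [this, Finset.card_range]

/-- If every subfamily has at least its proportional share of the rank `k`, then the family has a
spanning subfamily whose total weight is at most its proportional share. -/
lemma exists_light_spanning {F V W : Type*} [Field F] [AddCommGroup W] [Module F W]
    [DecidableEq V] (r : V → W) (w : V → ℕ) (T : Finset V) {k : ℕ}
    (hk : Module.finrank F (Submodule.span F (r '' (T : Set V))) = k)
    (hU : ∀ U ⊆ T, U.card * k ≤
      T.card * Module.finrank F (Submodule.span F (r '' (U : Set V)))) :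
    ∃ R ⊆ T, Submodule.span F (r '' (R : Set V)) = Submodule.span F (r '' (T : Set V)) ∧
      T.card * ∑ v ∈ R, w v ≤ k * ∑ v ∈ T, w v := by
  obtain ⟨R, hRT, hlin, hspan⟩ := exists_linearIndepOn_span_sublevel (F := F) r w T
  set B := ∑ v ∈ T, w v with hBdef
  have hB : ∀ v ∈ T, w v ≤ B := fun v hv => Finset.single_le_sum (fun _ _ => Nat.zero_le _) hv
  have hall : Submodule.span F (r '' (R : Set V)) = Submodule.span F (r '' (T : Set V)) := by
    have h := hspan B
    have h1 : {v | v ∈ R ∧ w v ≤ B} = (R : Set V) := by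
      ext v; simpa using fun hv => hB v (hRT hv)
    have h2 : {v | v ∈ T ∧ w v ≤ B} = (T : Set V) := by
      ext v; simpa using fun hv => hB v hv
    rwa [h1, h2] at h
  refine ⟨R, hRT, hall, ?_⟩
  have hcard : ∀ U : Finset V,
      Module.finrank F (Submodule.span F (r '' (U : Set V))) ≤ U.card := by
    intro U
    classical
    rw [← Finset.coe_image]
    exact (finrank_span_finset_le_card _).trans Finset.card_image_le
  have hRk : R.card ≤ k := by
    have h := finrank_span_eq_card hlin
    rw [← hk, ← hall, Set.image_eq_range, h]
    simp
  rw [hBdef, sum_eq_sum_range_card_lt w T hB,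
    sum_eq_sum_range_card_lt w R (fun v hv => hB v (hRT hv)), Finset.mul_sum, Finset.mul_sum]
  refine Finset.sum_le_sum fun τ _ => ?_
  have hR := Finset.card_filter_add_card_filter_not (s := R) (fun v => w v ≤ τ)
  have hT := Finset.card_filter_add_card_filter_not (s := T) (fun v => w v ≤ τ)
  simp only [not_le] at hR hT
  have h1 := hU (T.filter fun v => w v ≤ τ) (Finset.filter_subset _ _)
  have h2 := hcard (R.filter fun v => w v ≤ τ)
  rw [Finset.coe_filter, hspan τ] at h2
  rw [Finset.coe_filter] at h1
  have h3 := h1.trans (Nat.mul_le_mul_left T.card h2)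
  have h4 := Nat.mul_le_mul_left T.card (hR.trans_le hRk)
  have h5 := congrArg (fun x => x * k) hT
  nlinarith

/-- The number of nonzero values of a function. -/
def supportCard {ι F : Type*} [Fintype ι] [Zero F] [DecidableEq F] (f : ι → F) : ℕ :=
  (Finset.univ.filter fun i => f i ≠ 0).card

/-- The number of functions with at most `L` nonzero values. -/
lemma card_supportCard_le {ι F : Type*} [Fintype ι] [DecidableEq ι] [Nonempty ι] [Zero F]
    [Fintype F] [DecidableEq F] (L : ℕ) :
    (Finset.univ.filter fun f : ι → F => supportCard f ≤ L).card ≤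
      (Fintype.card ι * Fintype.card F) ^ L := by
  classical
  induction L with
  | zero =>
    rw [pow_zero, Finset.card_le_one]
    have h0 : ∀ f : ι → F, supportCard f ≤ 0 → f = 0 := by
      intro f hf
      ext i
      by_contra hi
      have : i ∈ (Finset.univ.filter fun i => f i ≠ 0) := by simpa using hi
      exact Finset.notMem_empty i (Finset.card_eq_zero.1 (Nat.le_zero.1 hf) ▸ this)
    intro f hf g hg
    rw [h0 f (Finset.mem_filter.1 hf).2, h0 g (Finset.mem_filter.1 hg).2]
  | succ L ih =>
    have hsub : (Finset.univ.filter fun f : ι → F => supportCard f ≤ L + 1) ⊆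
        ((Finset.univ.filter fun f : ι → F => supportCard f ≤ L) ×ˢ
          (Finset.univ : Finset (ι × F))).image
          fun x => Function.update x.1 x.2.1 x.2.2 := by
      intro f hf
      have hf := (Finset.mem_filter.1 hf).2
      obtain ⟨i, hi⟩ : ∃ i, supportCard (Function.update f i 0) ≤ L := by
        by_cases h : ∃ i, f i ≠ 0
        · obtain ⟨i, hi⟩ := h
          refine ⟨i, Nat.le_of_lt_succ (lt_of_lt_of_le ?_ hf)⟩
          apply Finset.card_lt_card
          rw [Finset.ssubset_iff_of_subset]
          · exact ⟨i, by simpa using hi, by simp⟩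
          · intro j hj
            by_cases hji : j = i
            · simp [hji] at hj
            · simpa [hji] using hj
        · push Not at h
          refine ⟨Classical.arbitrary ι, ?_⟩
          have : f = 0 := funext h
          subst this
          simp [supportCard]
      refine Finset.mem_image.2 ⟨(Function.update f i 0, i, f i), ?_, by simp⟩
      simp [hi]
    refine ((Finset.card_le_card hsub).trans Finset.card_image_le).trans ?_
    rw [Finset.card_product, Finset.card_univ, Fintype.card_prod, pow_succ]
    exact Nat.mul_le_mul_right _ ih

lemma supportCard_uncurry {V F : Type*} [Fintype V] [Zero F] [DecidableEq F] (N : V → V → F) :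
    supportCard (Function.uncurry N) = ∑ i, (Finset.univ.filter fun j => N i j ≠ 0).card := by
  rw [supportCard, Finset.card_filter, Fintype.sum_prod_type]
  exact Finset.sum_congr rfl fun i _ => by rw [Finset.card_filter]; rfl

/-- The matrix obtained by zeroing all entries outside the principal submatrix on `U`. -/
def principalPart {V F : Type*} [Zero F] [DecidableEq V] (M : Matrix V V F) (U : Finset V) :
    Matrix V V F :=
  Matrix.of fun i j => if i ∈ U ∧ j ∈ U then M i j else 0

lemma principalPart_transpose {V F : Type*} [Zero F] [DecidableEq V] (M : Matrix V V F)
    (U : Finset V) : principalPart Mᵀ U = (principalPart M U)ᵀ := by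
  ext i j
  simp [principalPart, and_comm]

lemma principalPart_principalPart {V F : Type*} [Zero F] [DecidableEq V] (M : Matrix V V F)
    {U T : Finset V} (h : U ⊆ T) : principalPart (principalPart M T) U = principalPart M U := by
  ext i j
  simp only [principalPart, Matrix.of_apply]
  split_ifs <;> grind

lemma principalPart_rank_le {V F : Type*} [Field F] [Fintype V] [DecidableEq V]
    (M : Matrix V V F) (U : Finset V) :
    (principalPart M U).rank ≤ Module.finrank F (Submodule.span F (M '' (U : Set V))) := by
  have hfac : principalPart M U =
      (Matrix.of fun i j => if i ∈ U then M i j else 0 : Matrix V V F) *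
        Matrix.diagonal fun j => if j ∈ U then 1 else 0 := by
    ext i j
    simp only [principalPart, Matrix.of_apply, Matrix.mul_diagonal]
    split_ifs <;> simp_all
  rw [hfac]
  refine (Matrix.rank_mul_le_left _ _).trans ?_
  rw [Matrix.rank_eq_finrank_span_row]
  refine Submodule.finrank_mono (Submodule.span_le.2 ?_)
  rintro _ ⟨i, rfl⟩
  by_cases hi : i ∈ U
  · refine Submodule.subset_span ⟨i, hi, ?_⟩
    ext j
    simp [Matrix.row, hi]
  · have h0 : (Matrix.of fun i j => if i ∈ U then M i j else 0 : Matrix V V F).row i = 0 := by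
      ext j
      simp [Matrix.row, hi]
    rw [h0]
    exact Submodule.zero_mem _

/-- If `N` is supported on rows in `T` and every principal part of `N` within `T` has at least its
proportional share of the rank, then `N` has a sparse spanning set of rows. -/
lemma exists_sparse_rows {V F : Type*} [Field F] [DecidableEq F] [Fintype V] [DecidableEq V]
    (N : Matrix V V F) (T : Finset V) (hN : ∀ i ∉ T, N i = 0)
    (hU : ∀ U ⊆ T, U.card * N.rank ≤ T.card * (principalPart N U).rank) :
    ∃ R : Finset V, Submodule.span F (N '' (R : Set V)) = Submodule.span F (Set.range N) ∧
      T.card * supportCard (Function.uncurry fun i j => if i ∈ R then N i j else 0) ≤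
        N.rank * supportCard (Function.uncurry N) := by
  classical
  have hT : Submodule.span F (N '' (T : Set V)) = Submodule.span F (Set.range N) := by
    refine le_antisymm (Submodule.span_mono (Set.image_subset_range _ _)) (Submodule.span_le.2 ?_)
    rintro _ ⟨i, rfl⟩
    by_cases hi : i ∈ T
    · exact Submodule.subset_span ⟨i, hi, rfl⟩
    · rw [hN i hi]
      exact Submodule.zero_mem _
  obtain ⟨R, -, hR, hw⟩ := exists_light_spanning (F := F) (fun i => N i)
    (fun i => (Finset.univ.filter fun j => N i j ≠ 0).card) T (k := N.rank)
    (by rw [Matrix.rank_eq_finrank_span_row]; exact congrArg (fun S : Submodule F (V → F) =>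
          Module.finrank F S) hT)
    (fun U h => (hU U h).trans (Nat.mul_le_mul_left _ (principalPart_rank_le N U)))
  refine ⟨R, hR.trans hT, ?_⟩
  have h1 : supportCard (Function.uncurry fun i j => if i ∈ R then N i j else 0) =
      ∑ i ∈ R, (Finset.univ.filter fun j => N i j ≠ 0).card := by
    rw [supportCard_uncurry, ← Finset.sum_filter_add_sum_filter_not _ (· ∈ R)]
    have h2 : ∑ i with i ∉ R,
        (Finset.univ.filter fun j => (if i ∈ R then N i j else 0) ≠ 0).card = 0 :=
      Finset.sum_eq_zero fun i hi => by simp [(Finset.mem_filter.1 hi).2]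
    rw [h2, add_zero, Finset.filter_univ_mem]
    exact Finset.sum_congr rfl fun i hi => by simp [hi]
  rw [h1, supportCard_uncurry (N : V → V → F)]
  exact hw.trans (Nat.mul_le_mul_left _ (Finset.sum_le_univ_sum_of_nonneg fun _ => Nat.zero_le _))

/-- `A` has the same row space as `N`, the nonzero columns of `B` are columns of `N`, and they
detect the nonzero vectors of the row space. -/
structure IsSkeleton {V F : Type*} [Field F] (N : Matrix V V F) (A B : V × V → F) : Prop where
  span_eq : Submodule.span F (Set.range N) = Submodule.span F (Set.range (Function.curry A))
  col_eq : ∀ j, (∃ i, B (i, j) ≠ 0) → ∀ i, N i j = B (i, j)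
  eq_zero : ∀ v ∈ Submodule.span F (Set.range N), (∀ j, (∃ i, B (i, j) ≠ 0) → v j = 0) → v = 0

lemma IsSkeleton.unique {V F : Type*} [Field F] {N N' : Matrix V V F} {A B : V × V → F}
    (h : IsSkeleton N A B) (h' : IsSkeleton N' A B) : N = N' := by
  have hrow : ∀ i, N i - N' i = 0 := by
    intro i
    refine h.eq_zero _ (Submodule.sub_mem _ (Submodule.subset_span ⟨i, rfl⟩) ?_) fun j hj => ?_
    · rw [h.span_eq, ← h'.span_eq]
      exact Submodule.subset_span ⟨i, rfl⟩
    · rw [Pi.sub_apply, h.col_eq j hj, h'.col_eq j hj, sub_self]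
  exact funext fun i => sub_eq_zero.1 (hrow i)

lemma isSkeleton_of_span {V F : Type*} [Field F] [Fintype V] [DecidableEq V] (N : Matrix V V F)
    (R C : Finset V) (hR : Submodule.span F (N '' (R : Set V)) = Submodule.span F (Set.range N))
    (hC : Submodule.span F (Nᵀ '' (C : Set V)) = Submodule.span F (Set.range Nᵀ)) :
    IsSkeleton N (Function.uncurry fun i j => if i ∈ R then N i j else 0)
      (Function.uncurry fun i j => if j ∈ C then N i j else 0) where
  span_eq := by
    rw [Function.curry_uncurry, ← hR]
    refine le_antisymm (Submodule.span_le.2 ?_) (Submodule.span_le.2 ?_)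
    · rintro _ ⟨i, hi, rfl⟩
      refine Submodule.subset_span ⟨i, ?_⟩
      ext j
      simp [Finset.mem_coe.1 hi]
    · rintro _ ⟨i, rfl⟩
      by_cases hi : i ∈ R
      · exact Submodule.subset_span ⟨i, hi, by simp [hi]⟩
      · simp only [hi, if_false]
        exact Submodule.zero_mem _
  col_eq := by
    rintro j ⟨i, hi⟩ i'
    have hj : j ∈ C := by
      by_contra hj
      simp [hj] at hi
    simp [hj]
  eq_zero := by
    intro v hv hzero
    obtain ⟨y, rfl⟩ : ∃ y : V → F, y ᵥ* N = v := by
      have : v ∈ LinearMap.range N.vecMulLinear := by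
        rw [_root_.range_vecMulLinear]
        exact hv
      exact this
    let φ : (V → F) →ₗ[F] F := dotProductBilin F F y
    have hker : Submodule.span F (Nᵀ '' (C : Set V)) ≤ LinearMap.ker φ := by
      refine Submodule.span_le.2 ?_
      rintro _ ⟨j, hj, rfl⟩
      change y ⬝ᵥ Nᵀ j = 0
      by_cases h : ∃ i, N i j ≠ 0
      · obtain ⟨i, hi⟩ := h
        exact hzero j ⟨i, by simpa [Finset.mem_coe.1 hj] using hi⟩
      · push Not at h
        simp [dotProduct, h]
    ext j
    exact hker (hC ▸ Submodule.subset_span ⟨j, rfl⟩)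

/-- Every matrix with nonzero diagonal has a principal part, of relative rank at most that of the
matrix, that is described by two sparse matrices. -/
lemma exists_principalPart_sparse_skeleton {V F : Type*} [Field F] [DecidableEq F]
    [Fintype V] [DecidableEq V] [Nonempty V] (M : Matrix V V F) (hM : ∀ v, M v v ≠ 0) :
    ∃ (T : Finset V) (A B : V × V → F), T.Nonempty ∧ IsSkeleton (principalPart M T) A B ∧
      (principalPart M T).rank * Fintype.card V ≤ T.card * M.rank ∧
      T.card ≤ supportCard A ∧
      T.card * supportCard A ≤
        (principalPart M T).rank * supportCard (Function.uncurry (principalPart M T)) ∧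
      T.card * supportCard B ≤
        (principalPart M T).rank * supportCard (Function.uncurry (principalPart M T)) := by
  classical
  obtain ⟨T, hT, hmin⟩ := Finset.exists_min_image
    (Finset.univ.filter fun U : Finset V => U.Nonempty)
    (fun U => ((principalPart M U).rank : ℚ) / U.card) ⟨Finset.univ, by simp⟩
  have hTne : T.Nonempty := (Finset.mem_filter.1 hT).2
  have hratio : ∀ U : Finset V,
      U.card * (principalPart M T).rank ≤ T.card * (principalPart M U).rank := by
    intro U
    rcases U.eq_empty_or_nonempty with rfl | hU
    · simp
    have h := hmin U (by simp [hU])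
    have hTc : (0 : ℚ) < T.card := by exact_mod_cast hTne.card_pos
    have hUc : (0 : ℚ) < U.card := by exact_mod_cast hU.card_pos
    rw [div_le_div_iff₀ hTc hUc] at h
    have h' : (principalPart M T).rank * U.card ≤ (principalPart M U).rank * T.card := by
      exact_mod_cast h
    linarith
  set N := principalPart M T with hNdef
  obtain ⟨R, hR, hRw⟩ := exists_sparse_rows N T
    (fun i hi => by ext j; simp [hNdef, principalPart, hi])
    (fun U hU => by rw [hNdef, principalPart_principalPart M hU]; exact hratio U)
  obtain ⟨C, hC, hCw⟩ := exists_sparse_rows Nᵀ T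
    (fun i hi => by ext j; simp [hNdef, principalPart, hi])
    (fun U hU => by
      rw [principalPart_transpose, Matrix.rank_transpose, Matrix.rank_transpose, hNdef,
        principalPart_principalPart M hU]
      exact hratio U)
  have hswap : ∀ P : V → V → F, supportCard (Function.uncurry fun i j => P j i) =
      supportCard (Function.uncurry P) := by
    intro P
    refine Finset.card_bij' (fun q _ => q.swap) (fun q _ => q.swap) ?_ ?_ ?_ ?_ <;> simp
  refine ⟨T, _, _, hTne, isSkeleton_of_span N R C hR hC, ?_, ?_, hRw, ?_⟩
  · have h := hratio Finset.univ
    have huniv : principalPart M Finset.univ = M := by ext i j; simp [principalPart]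
    rw [huniv, Finset.card_univ] at h
    linarith
  · have hsub : T ⊆ (Finset.univ.filter fun q : V × V =>
        (Function.uncurry fun i j => if i ∈ R then N i j else 0) q ≠ 0).image Prod.snd := by
      intro j hj
      by_contra hcon
      have hcol : ∀ i ∈ R, N i j = 0 := by
        intro i hi
        by_contra hne
        exact hcon (Finset.mem_image.2 ⟨(i, j), by simpa [hi] using hne, rfl⟩)
      have hker : Submodule.span F (N '' (R : Set V)) ≤
          LinearMap.ker (LinearMap.proj j : (V → F) →ₗ[F] F) := by
        refine Submodule.span_le.2 ?_
        rintro _ ⟨i, hi, rfl⟩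
        exact hcol i hi
      have : N j j = 0 := hker (hR ▸ Submodule.subset_span ⟨j, rfl⟩)
      refine hM j ?_
      simpa [hNdef, principalPart, hj] using this
    exact (Finset.card_le_card hsub).trans Finset.card_image_le
  · rw [Matrix.rank_transpose] at hCw
    rw [← hswap, ← hswap N]
    exact hCw

/-- The edges of the image of `H` under `φ`. -/
noncomputable def imageEdges {W V : Type*} [Fintype W] [DecidableEq V] (H : SimpleGraph W)
    (φ : W → V) : Finset (Sym2 V) := by
  classical exact H.edgeFinset.image (Sym2.map φ)

lemma card_imageEdges {W V : Type*} [Fintype W] [DecidableEq V] (H : SimpleGraph W)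
    {φ : W → V} (hφ : Function.Injective φ) : (imageEdges H φ).card = H.edgeSet.ncard := by
  classical
  rw [imageEdges, Finset.card_image_of_injective _ (Sym2.map.injective hφ),
    ← SimpleGraph.coe_edgeFinset, Set.ncard_coe_finset]

lemma mem_imageEdges {W V : Type*} [Fintype W] [DecidableEq V] {H : SimpleGraph W} {φ : W → V}
    {a b : W} (hab : H.Adj a b) : s(φ a, φ b) ∈ imageEdges H φ := by
  classical
  exact Finset.mem_image.2 ⟨s(a, b), by simpa using hab, rfl⟩

lemma exists_of_mem_imageEdges {W V : Type*} [Fintype W] [DecidableEq V] {H : SimpleGraph W}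
    {φ : W → V} {x y : V} (h : s(x, y) ∈ imageEdges H φ) :
    ∃ a b, H.Adj a b ∧ φ a = x ∧ φ b = y := by
  classical
  obtain ⟨e, he, hxy⟩ := Finset.mem_image.1 h
  induction e using Sym2.ind with
  | _ a b =>
    have hab : H.Adj a b := by simpa using he
    rw [Sym2.map_mk, Sym2.eq_iff] at hxy
    rcases hxy with ⟨h1, h2⟩ | ⟨h1, h2⟩
    · exact ⟨a, b, hab, h1, h2⟩
    · exact ⟨b, a, hab.symm, h2, h1⟩

lemma card_filter_apply_eq_and_apply_eq_le {W V : Type*} [Fintype W] [DecidableEq W] [Fintype V]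
    [DecidableEq V] {a b : W} (hab : a ≠ b) (x y : V) :
    (Finset.univ.filter fun φ : W → V => φ a = x ∧ φ b = y).card ≤
      Fintype.card V ^ (Fintype.card W - 2) := by
  have hsub : (Finset.univ.filter fun φ : W → V => φ a = x ∧ φ b = y) ⊆
      Fintype.piFinset fun i => if i = a then {x} else if i = b then {y} else Finset.univ := by
    intro φ hφ
    obtain ⟨h1, h2⟩ := (Finset.mem_filter.1 hφ).2
    rw [Fintype.mem_piFinset]
    intro i
    split_ifs with hi hi'
    · simp [hi, h1]
    · simp [hi', h2]
    · simp
  refine (Finset.card_le_card hsub).trans ?_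
  rw [Fintype.card_piFinset]
  have hb : b ∈ (Finset.univ : Finset W).erase a := by simp [hab.symm]
  rw [← Finset.mul_prod_erase _ _ (Finset.mem_univ a), ← Finset.mul_prod_erase _ _ hb]
  have hrest : ∏ i ∈ ((Finset.univ : Finset W).erase a).erase b,
      (if i = a then {x} else if i = b then {y} else (Finset.univ : Finset V)).card =
      ∏ i ∈ ((Finset.univ : Finset W).erase a).erase b, Fintype.card V := by
    refine Finset.prod_congr rfl fun i hi => ?_
    rw [Finset.mem_erase, Finset.mem_erase] at hi
    simp [hi.1, hi.2.1]
  rw [hrest, Finset.prod_const, Finset.card_erase_of_mem hb,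
    Finset.card_erase_of_mem (Finset.mem_univ a), Finset.card_univ]
  simp [hab.symm, Nat.sub_sub]

/-- A criterion for the existence of an `H`-free graph meeting all the edge sets `S i`. -/
lemma exists_copy_free_transversal {W V ι : Type*} [Fintype W] [Fintype V] [DecidableEq V]
    (H : SimpleGraph W) (hH : H.edgeSet.ncard ≠ 0) {p : ℝ} (hp0 : 0 ≤ p) (hp : p ≤ 1 / 2)
    (hΔ : ((Fintype.card W) ^ 2 * (Fintype.card V) ^ (Fintype.card W - 2) : ℝ) *
      (2 * p) ^ H.edgeSet.ncard ≤ p / 2)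
    (I : Finset ι) (S : ι → Finset (Sym2 V))
    (hI : ∑ i ∈ I, Real.exp (-(p * (S i).card / 2)) < 1) :
    ∃ Γ : Finset (Sym2 V), ¬ ContainsCopy H (SimpleGraph.fromEdgeSet (Γ : Set (Sym2 V))) ∧
      ∀ i ∈ I, (Γ ∩ S i).Nonempty := by
  classical
  set 𝓗 := (Finset.univ.filter fun φ : W → V => Function.Injective φ).image (imageEdges H)
    with h𝓗
  have hcard : ∀ X ∈ 𝓗, X.card = H.edgeSet.ncard := by
    intro X hX
    obtain ⟨φ, hφ, rfl⟩ := Finset.mem_image.1 hX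
    exact card_imageEdges H (Finset.mem_filter.1 hφ).2
  have hdeg : ∀ e, ((𝓗.filter fun X => e ∈ X).card : ℝ) ≤
      (Fintype.card W) ^ 2 * (Fintype.card V) ^ (Fintype.card W - 2) := by
    intro e
    induction e using Sym2.ind with
    | _ x y =>
      have hsub : (𝓗.filter fun X => s(x, y) ∈ X) ⊆
          ((Finset.univ : Finset (W × W)).biUnion fun q => if q.1 = q.2 then ∅ else
            Finset.univ.filter fun φ : W → V => φ q.1 = x ∧ φ q.2 = y).image (imageEdges H) := by
        intro X hX
        obtain ⟨hX, hxy⟩ := Finset.mem_filter.1 hX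
        obtain ⟨φ, -, rfl⟩ := Finset.mem_image.1 hX
        obtain ⟨a, b, hab, h1, h2⟩ := exists_of_mem_imageEdges hxy
        refine Finset.mem_image_of_mem _ (Finset.mem_biUnion.2 ⟨(a, b), Finset.mem_univ _, ?_⟩)
        simp [hab.ne, h1, h2]
      have hle := (Finset.card_le_card hsub).trans (Finset.card_image_le.trans
        (Finset.card_biUnion_le_card_mul _ _
          (Fintype.card V ^ (Fintype.card W - 2)) fun q _ => ?_))
      · rw [Finset.card_univ, Fintype.card_prod, ← sq] at hle
        exact_mod_cast hle
      · split_ifs with hq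
        · simp
        · exact card_filter_apply_eq_and_apply_eq_le hq x y
  obtain ⟨Γ, hfree, hmeet⟩ := exists_independent_transversal hp0 hp hH 𝓗 hcard hdeg hΔ I S hI
  refine ⟨Γ, ?_, hmeet⟩
  rintro ⟨φ, hφ, hadj⟩
  refine hfree _ (Finset.mem_image_of_mem _ (by simpa using hφ)) fun e he => ?_
  induction e using Sym2.ind with
  | _ x y =>
    obtain ⟨a, b, hab, rfl, rfl⟩ := exists_of_mem_imageEdges he
    exact ((SimpleGraph.fromEdgeSet_adj _).1 (hadj a b hab)).1

/-- The unordered pairs of distinct indices at which one of the two entries of `N` is nonzero. -/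
def offDiagSupport {V F : Type*} [Fintype V] [DecidableEq V] [Zero F] [DecidableEq F]
    (N : Matrix V V F) : Finset (Sym2 V) :=
  (Finset.univ.filter fun q : V × V => q.1 ≠ q.2 ∧ N q.1 q.2 ≠ 0).image fun q => s(q.1, q.2)

lemma supportCard_principalPart_le {V F : Type*} [Fintype V] [DecidableEq V] [Zero F]
    [DecidableEq F] (M : Matrix V V F) (T : Finset V) :
    supportCard (Function.uncurry (principalPart M T)) ≤
      T.card + 2 * (offDiagSupport (principalPart M T)).card := by
  set N := principalPart M T with hN
  have hsub : (Finset.univ.filter fun q : V × V => Function.uncurry N q ≠ 0) ⊆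
      T.image (fun v => (v, v)) ∪
        Finset.univ.filter fun q : V × V => q.1 ≠ q.2 ∧ N q.1 q.2 ≠ 0 := by
    rintro ⟨i, j⟩ hq
    have hq : N i j ≠ 0 := (Finset.mem_filter.1 hq).2
    rw [Finset.mem_union]
    by_cases hij : i = j
    · subst hij
      have hi : i ∈ T := by
        by_contra hi
        simp [hN, principalPart, hi] at hq
      exact Or.inl (Finset.mem_image_of_mem _ hi)
    · exact Or.inr (by simp [hij, hq])
  refine (Finset.card_le_card hsub).trans ((Finset.card_union_le _ _).trans
    (Nat.add_le_add Finset.card_image_le (Finset.card_le_mul_card_image _ 2 fun e _ => ?_)))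
  induction e using Sym2.ind with
  | _ x y =>
    refine (Finset.card_le_card (t := {(x, y), (y, x)}) ?_).trans Finset.card_le_two
    rintro ⟨i, j⟩ hq
    have h := (Finset.mem_filter.1 hq).2
    rw [Sym2.eq_iff] at h
    simpa using h

lemma sum_Icc_inv_sixteen_pow_lt_one (K : ℕ) : ∑ L ∈ Finset.Icc 1 K, (1 / 16 : ℝ) ^ L < 1 := by
  have h : ∑ L ∈ Finset.Icc 1 K, (1 / 16 : ℝ) ^ L ≤ 1 - (1 / 16) ^ K := by
    induction K with
    | zero => simp
    | succ K ih =>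
      rw [Finset.sum_Icc_succ_top (by omega)]
      have : (0 : ℝ) < (1 / 16) ^ K := by positivity
      rw [pow_succ]
      linarith
  have : (0 : ℝ) < (1 / 16) ^ K := by positivity
  linarith

/-- The union bound over all skeletons of sparsity `L`. -/
lemma skeleton_count_mul_exp_le {n q x : ℝ} (hn : 1 ≤ n) (hq : 1 ≤ q) (hnq : 4 ≤ n * q)
    (hx : 6 * Real.log (n * q) ≤ x) (L : ℕ) :
    ((n ^ 2 * q) ^ L) ^ 2 * Real.exp (-(L * x)) ≤ (1 / 16) ^ L := by
  have hpos : 0 < n * q := by linarith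
  have hexp : Real.exp (-x) ≤ ((n * q) ^ 6)⁻¹ := by
    rw [Real.exp_neg]
    refine inv_anti₀ (by positivity) ?_
    calc (n * q) ^ 6 = Real.exp (6 * Real.log (n * q)) := by
          rw [← Real.exp_log hpos, ← Real.exp_nat_mul, Real.log_exp]; norm_num
      _ ≤ _ := Real.exp_le_exp.2 hx
  have hbase : (n ^ 2 * q) ^ 2 * Real.exp (-x) ≤ 1 / 16 := by
    have hle : n ^ 2 * q ≤ (n * q) ^ 2 := by
      rw [mul_pow]
      gcongr
      nlinarith
    calc (n ^ 2 * q) ^ 2 * Real.exp (-x) ≤ ((n * q) ^ 2) ^ 2 * ((n * q) ^ 6)⁻¹ := by gcongr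
      _ = 1 / (n * q) ^ 2 := by field_simp
      _ ≤ 1 / 16 := by
        gcongr
        nlinarith
  calc ((n ^ 2 * q) ^ L) ^ 2 * Real.exp (-(L * x))
      = ((n ^ 2 * q) ^ 2 * Real.exp (-x)) ^ L := by
        rw [mul_pow _ (Real.exp (-x)), ← Real.exp_nat_mul, mul_neg, pow_right_comm]
    _ ≤ _ := by gcongr

/-- A matrix representing `G` yields a principal part with a sparse skeleton and large off-diagonal
support. -/
lemma exists_skeleton_large_offDiagSupport {V F : Type*} [Field F] [DecidableEq F]
    [Fintype V] [DecidableEq V] [Nonempty V] (M : Matrix V V F) (hM : ∀ v, M v v ≠ 0) {κ : ℝ}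
    (hκ : (M.rank : ℝ) ≤ κ) (hκ' : 2 * κ ≤ Fintype.card V) :
    ∃ (T : Finset V) (A B : V × V → F) (L : ℕ), IsSkeleton (principalPart M T) A B ∧
      1 ≤ L ∧ L ≤ Fintype.card V ^ 2 ∧ supportCard A ≤ L ∧ supportCard B ≤ L ∧
      (L * Fintype.card V : ℝ) ≤ 4 * κ * (offDiagSupport (principalPart M T)).card := by
  obtain ⟨T, A, B, hT, hskel, hrank, hTA, hA, hB⟩ := exists_principalPart_sparse_skeleton M hM
  have hTpos := hT.card_pos
  have hcard : ∀ f : V × V → F, supportCard f ≤ Fintype.card V ^ 2 := fun f =>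
    (Finset.card_le_univ _).trans (by rw [Fintype.card_prod, sq])
  refine ⟨T, A, B, max (supportCard A) (supportCard B), hskel, le_max_of_le_left (by omega),
    max_le (hcard A) (hcard B), le_max_left _ _, le_max_right _ _, ?_⟩
  set L := max (supportCard A) (supportCard B) with hLdef
  set k := (principalPart M T).rank
  set s := supportCard (Function.uncurry (principalPart M T))
  set d := (offDiagSupport (principalPart M T)).card
  have hTL : T.card ≤ L := hTA.trans (le_max_left _ _)
  have hLs : T.card * L ≤ k * s := by
    rcases max_choice (supportCard A) (supportCard B) with h | h <;> rw [hLdef, h] <;> assumption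
  have hsd : s ≤ T.card + 2 * d := supportCard_principalPart_le M T
  have hn : (0 : ℝ) < Fintype.card V := by exact_mod_cast Fintype.card_pos
  have ht : (0 : ℝ) < T.card := by exact_mod_cast hTpos
  have h1 : (T.card * L : ℝ) ≤ k * s := by exact_mod_cast hLs
  have h2 : (k * Fintype.card V : ℝ) ≤ T.card * κ :=
    le_trans (by exact_mod_cast hrank) (mul_le_mul_of_nonneg_left hκ ht.le)
  have h3 : (T.card : ℝ) ≤ L := by exact_mod_cast hTL
  have h4 : (s : ℝ) ≤ T.card + 2 * d := by exact_mod_cast hsd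
  have hκ0 : 0 ≤ κ := le_trans (Nat.cast_nonneg _) hκ
  have h5 : (L * Fintype.card V : ℝ) ≤ κ * s := by
    have : (T.card : ℝ) * (L * Fintype.card V) ≤ T.card * (κ * s) := by
      calc (T.card : ℝ) * (L * Fintype.card V) = T.card * L * Fintype.card V := by ring
        _ ≤ k * s * Fintype.card V := by gcongr
        _ = k * Fintype.card V * s := by ring
        _ ≤ T.card * κ * s := by gcongr
        _ = _ := by ring
    exact le_of_mul_le_mul_left this ht
  have h6 : 2 * κ * T.card ≤ L * Fintype.card V := by
    calc 2 * κ * T.card ≤ Fintype.card V * L := by gcongr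
      _ = _ := by ring
  have h7 : κ * s ≤ κ * (T.card + 2 * d) := by gcongr
  linarith

/-- A lower bound on the minrank of a graph with `H`-free complement, with free parameters. -/
lemma exists_compl_copy_free_le_minrk {W V F : Type*} [Fintype W] [Fintype V] [Nonempty V]
    [Field F] [Fintype F] (H : SimpleGraph W) (hH : H.edgeSet.ncard ≠ 0) {p κ : ℝ} (hp0 : 0 < p)
    (hp : p ≤ 1 / 2)
    (hΔ : ((Fintype.card W) ^ 2 * (Fintype.card V) ^ (Fintype.card W - 2) : ℝ) *
      (2 * p) ^ H.edgeSet.ncard ≤ p / 2)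
    (hκ0 : 0 < κ) (hκ : 2 * κ ≤ Fintype.card V)
    (hcard : (4 : ℝ) ≤ Fintype.card V * Fintype.card F)
    (hlog : 6 * Real.log (Fintype.card V * Fintype.card F) ≤ p * Fintype.card V / (8 * κ)) :
    ∃ G : SimpleGraph V, ¬ ContainsCopy H Gᶜ ∧ κ ≤ minrk F G := by
  classical
  let valid : ℕ → (V × V → F) × (V × V → F) → Prop := fun L c =>
    ∃ N : Matrix V V F, IsSkeleton N c.1 c.2 ∧
      (L * Fintype.card V : ℝ) ≤ 4 * κ * (offDiagSupport N).card
  let ball : ℕ → Finset (V × V → F) := fun L => Finset.univ.filter fun f => supportCard f ≤ L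
  let I : Finset (Σ _ : ℕ, (V × V → F) × (V × V → F)) :=
    (Finset.Icc 1 (Fintype.card V ^ 2)).sigma fun L => (ball L ×ˢ ball L).filter (valid L)
  let S : (Σ _ : ℕ, (V × V → F) × (V × V → F)) → Finset (Sym2 V) := fun i =>
    if h : valid i.1 i.2 then offDiagSupport h.choose else ∅
  have hsum : ∑ i ∈ I, Real.exp (-(p * (S i).card / 2)) < 1 := by
    rw [Finset.sum_sigma]
    refine lt_of_le_of_lt (Finset.sum_le_sum fun L _ => ?_)
      (sum_Icc_inv_sixteen_pow_lt_one (Fintype.card V ^ 2))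
    have hball : ((ball L).card : ℝ) ≤ ((Fintype.card V : ℝ) ^ 2 * Fintype.card F) ^ L := by
      have h := card_supportCard_le (ι := V × V) (F := F) L
      rw [Fintype.card_prod, ← sq] at h
      exact_mod_cast h
    calc ∑ c ∈ (ball L ×ˢ ball L).filter (valid L), Real.exp (-(p * (S ⟨L, c⟩).card / 2))
        ≤ ∑ c ∈ (ball L ×ˢ ball L).filter (valid L),
            Real.exp (-(L * (p * Fintype.card V / (8 * κ)))) := by
          refine Finset.sum_le_sum fun c hc => Real.exp_le_exp.2 (neg_le_neg ?_)
          have hv : valid L c := (Finset.mem_filter.1 hc).2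
          have hS : S ⟨L, c⟩ = offDiagSupport hv.choose := dif_pos hv
          have h := hv.choose_spec.2
          rw [← hS] at h
          rw [← mul_div_assoc, div_le_iff₀ (by positivity)]
          calc (L : ℝ) * (p * Fintype.card V) = p * (L * Fintype.card V) := by ring
            _ ≤ p * (4 * κ * (S ⟨L, c⟩).card) := by gcongr
            _ = _ := by ring
      _ ≤ (ball L ×ˢ ball L).card * Real.exp (-(L * (p * Fintype.card V / (8 * κ)))) := by
          rw [Finset.sum_const, nsmul_eq_mul]
          gcongr
          exact Finset.filter_subset _ _
      _ ≤ (((Fintype.card V : ℝ) ^ 2 * Fintype.card F) ^ L) ^ 2 *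
            Real.exp (-(L * (p * Fintype.card V / (8 * κ)))) := by
          rw [Finset.card_product, Nat.cast_mul, ← sq]
          gcongr
      _ ≤ (1 / 16) ^ L := skeleton_count_mul_exp_le
          (by exact_mod_cast Fintype.card_pos) (by exact_mod_cast Fintype.card_pos) hcard hlog L
  obtain ⟨Γ, hfree, hmeet⟩ := exists_copy_free_transversal H hH hp0.le hp hΔ I S hsum
  refine ⟨(SimpleGraph.fromEdgeSet (Γ : Set (Sym2 V)))ᶜ, by rwa [compl_compl], ?_⟩
  set G := (SimpleGraph.fromEdgeSet (Γ : Set (Sym2 V)))ᶜ with hG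
  by_contra! hlt
  have hne : {r : ℕ | ∃ M : Matrix V V F, Represents M G ∧ M.rank = r}.Nonempty :=
    ⟨_, 1, ⟨fun v => by simp, fun u v huv _ => Matrix.one_apply_ne huv⟩, rfl⟩
  obtain ⟨M, hM, hrank⟩ := Nat.sInf_mem hne
  have hMκ : (M.rank : ℝ) ≤ κ := by rw [hrank]; exact hlt.le
  obtain ⟨T, A, B, L, hskel, hL1, hL2, hA, hB, hlarge⟩ :=
    exists_skeleton_large_offDiagSupport M hM.1 hMκ hκ
  have hv : valid L (A, B) := ⟨_, hskel, hlarge⟩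
  have hI : (⟨L, (A, B)⟩ : Σ _ : ℕ, (V × V → F) × (V × V → F)) ∈ I := by
    simp [I, ball, hL1, hL2, hA, hB, hv]
  have hS : S ⟨L, (A, B)⟩ = offDiagSupport (principalPart M T) := by
    rw [← hv.choose_spec.1.unique hskel]
    exact dif_pos hv
  obtain ⟨e, he⟩ := hmeet _ hI
  rw [hS, Finset.mem_inter] at he
  obtain ⟨⟨u, v⟩, huv, rfl⟩ := Finset.mem_image.1 he.2
  obtain ⟨hne, hN⟩ := (Finset.mem_filter.1 huv).2
  have hzero : M u v = 0 := by
    refine hM.2 u v hne fun hadj => ?_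
    rw [hG, SimpleGraph.compl_adj, SimpleGraph.fromEdgeSet_adj] at hadj
    exact hadj.2 ⟨he.1, hne⟩
  exact hN (by simp [principalPart, hzero])

/-- For a graph H with h ≥ 3 vertices and f ≥ 3 edges, with γ(H) = (h-2)/(f-1),
there is c > 0 (depending only on H) such that for every n ≥ 2 and finite field F there is an
n-vertex graph G whose complement is H-free with minrk_F(G) ≥ c · n^{1-γ(H)} / log(n·|F|). -/
theorem exists_compl_free_minrk_ge {h : ℕ} (H : SimpleGraph (Fin h))
    (hh : 3 ≤ h) (hf : 3 ≤ H.edgeSet.ncard) :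
    ∃ c : ℝ, 0 < c ∧ ∀ n : ℕ, 2 ≤ n → ∀ (F : Type) [Field F] [Fintype F],
      ∃ G : SimpleGraph (Fin n), ¬ ContainsCopy H Gᶜ ∧
        c * (n : ℝ) ^ (1 - ((h : ℝ) - 2) / ((H.edgeSet.ncard : ℝ) - 1)) /
          Real.log ((n : ℝ) * (Fintype.card F : ℝ)) ≤ (minrk F G : ℝ) := by
  set m := H.edgeSet.ncard with hm
  set γ : ℝ := ((h : ℝ) - 2) / ((m : ℝ) - 1) with hγ
  have hh' : (3 : ℝ) ≤ h := by exact_mod_cast hh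
  have hm' : (3 : ℝ) ≤ m := by exact_mod_cast hf
  have hγ0 : 0 ≤ γ := div_nonneg (by linarith) (by linarith)
  set δ : ℝ := 1 / ((h : ℝ) ^ 2 * 2 ^ (m + 1)) with hδ
  have hδ0 : 0 < δ := by positivity
  have hδ1 : δ ≤ 1 / 2 := by
    rw [hδ]
    gcongr
    have h2 : (2 : ℝ) ^ 1 ≤ 2 ^ (m + 1) := pow_le_pow_right₀ (by norm_num) (by omega)
    nlinarith
  refine ⟨δ / 48, by positivity, fun n hn F _ _ => ?_⟩
  have : Nonempty (Fin n) := ⟨⟨0, by omega⟩⟩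
  have hn' : (2 : ℝ) ≤ n := by exact_mod_cast hn
  have hn0 : (0 : ℝ) < n := by linarith
  have hq : (2 : ℝ) ≤ Fintype.card F := by
    exact_mod_cast (Fintype.one_lt_card : 1 < Fintype.card F)
  have hcard : (4 : ℝ) ≤ n * Fintype.card F := by nlinarith
  have hlog1 : 1 ≤ Real.log (n * Fintype.card F) := by
    rw [Real.le_log_iff_exp_le (by linarith)]
    linarith [Real.exp_one_lt_d9]
  set ℓ := Real.log (n * Fintype.card F) with hℓ
  have hpow0 : (0 : ℝ) < (n : ℝ) ^ (1 - γ) := by positivity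
  have hpow1 : (n : ℝ) ^ (1 - γ) ≤ n := by
    calc (n : ℝ) ^ (1 - γ) ≤ (n : ℝ) ^ (1 : ℝ) :=
          Real.rpow_le_rpow_of_exponent_le (by linarith) (by linarith)
      _ = n := Real.rpow_one _
  have hneg0 : (0 : ℝ) < (n : ℝ) ^ (-γ) := by positivity
  have hneg1 : (n : ℝ) ^ (-γ) ≤ 1 :=
    Real.rpow_le_one_of_one_le_of_nonpos (by linarith) (by linarith)
  refine exists_compl_copy_free_le_minrk (p := δ * (n : ℝ) ^ (-γ)) H (by omega) (by positivity)
    ?_ ?_ (by positivity) ?_ ?_ ?_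
  · nlinarith
  · simp only [Fintype.card_fin]
    rw [← hm]
    have hcancel : (n : ℝ) ^ (h - 2) * ((n : ℝ) ^ (-γ)) ^ (m - 1) = 1 := by
      rw [← Real.rpow_natCast, ← Real.rpow_natCast, ← Real.rpow_mul hn0.le, ← Real.rpow_add hn0,
        Nat.cast_sub (by omega), Nat.cast_sub (by omega)]
      have : ((h : ℝ) - (2 : ℕ)) + -γ * ((m : ℝ) - (1 : ℕ)) = 0 := by
        have : (m : ℝ) - 1 ≠ 0 := by linarith
        rw [hγ]
        push_cast
        field_simp
        ring
      rw [this, Real.rpow_zero]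
    have hδm : δ ^ (m - 1) ≤ δ := pow_le_of_le_one hδ0.le (by linarith) (by omega)
    have hsplit : ∀ x : ℝ, x ^ m = x ^ (m - 1) * x := fun x => by
      rw [← pow_succ, Nat.sub_add_cancel (by omega)]
    calc (h : ℝ) ^ 2 * (n : ℝ) ^ (h - 2) * (2 * (δ * (n : ℝ) ^ (-γ))) ^ m
        = (h : ℝ) ^ 2 * 2 ^ m * δ ^ (m - 1) * (δ * (n : ℝ) ^ (-γ)) *
            ((n : ℝ) ^ (h - 2) * ((n : ℝ) ^ (-γ)) ^ (m - 1)) := by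
          rw [mul_pow, hsplit (δ * (n : ℝ) ^ (-γ)), mul_pow]; ring
      _ = (h : ℝ) ^ 2 * 2 ^ m * δ ^ (m - 1) * (δ * (n : ℝ) ^ (-γ)) := by rw [hcancel, mul_one]
      _ ≤ (h : ℝ) ^ 2 * 2 ^ m * δ * (δ * (n : ℝ) ^ (-γ)) := by gcongr
      _ = 1 / 2 * (δ * (n : ℝ) ^ (-γ)) := by
          congr 1
          rw [hδ, pow_succ (2 : ℝ) m]
          field_simp
      _ = _ := by ring
  · rw [Fintype.card_fin]
    have : δ / 48 * (n : ℝ) ^ (1 - γ) / ℓ ≤ δ / 48 * (n : ℝ) ^ (1 - γ) :=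
      div_le_self (by positivity) hlog1
    nlinarith
  · rwa [Fintype.card_fin]
  · rw [Fintype.card_fin]
    refine le_of_eq ?_
    have hmul : (n : ℝ) ^ (1 - γ) = (n : ℝ) ^ (-γ) * n := by
      rw [sub_eq_neg_add, Real.rpow_add_one hn0.ne']
    rw [← hℓ, hmul]
    field_simp
    norm_num
end
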